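/- Let X be a metric space and n ∈ ℕ ∪ {∞}, and suppose Δ(X)^(n) is a large scale absolute extensor of X, i.e., for all ε > 0 there is δ > 0 such that for any subset A of X every (δ,δ)-Lipschitz function f : A → Δ(X)^(n) extends to an (ε,ε)-Lipschitz function g : X → Δ(X)^(n). If X is of countable asymptotic dimension, then for every set S of cardinality bigger than card(X × ℕ) and every ε > 0 there exists an (ε,ε)-Lipschitz partition of unity g : X → Δ(S)^(n) that is K-cobounded for some K > 0. -/

import Mathlib

universe u

/-- The `l¹` distance between two (finitely supported) functions `S → ℝ`,
modeling the metric of `Δ(S) ⊆ l¹(S)`. -/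
noncomputable def l1dist {S : Type*} (φ ψ : S → ℝ) : ℝ := ∑ᶠ v, |φ v - ψ v|

/-- `φ` is a point of `Δ(S)`. -/
def IsDelta {S : Type*} (φ : S → ℝ) : Prop :=
  (∀ v, 0 ≤ φ v) ∧ (Function.support φ).Finite ∧ ∑ᶠ v, φ v = 1

/-- `φ` is a point of the `n`-skeleton `Δ(S)⁽ⁿ⁾` (with `Δ(S)⁽∞⁾ = Δ(S)`). -/
def IsDeltaSkel {S : Type*} (n : ℕ∞) (φ : S → ℝ) : Prop :=
  IsDelta φ ∧ (Function.support φ).encard ≤ n + 1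

/-- `f` is a partition of unity on `A` with values in `Δ(S)⁽ⁿ⁾`. -/
def PartUnitySkelOn {X S : Type*} (n : ℕ∞) (f : X → S → ℝ) (A : Set X) : Prop :=
  ∀ a ∈ A, IsDeltaSkel n (f a)

/-- `f` is `(ε,ε)`-Lipschitz on `A` (with respect to the `l¹` metric on `Δ(S)`). -/
def LipschitzEpsOn {X S : Type*} [MetricSpace X] (ε : ℝ) (f : X → S → ℝ) (A : Set X) : Prop :=
  ∀ x ∈ A, ∀ y ∈ A, l1dist (f x) (f y) ≤ ε * dist x y + ε

/-- `f` is `K`-cobounded on `A`. -/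
def CoboundedOn {X S : Type*} [MetricSpace X] (K : ℝ) (f : X → S → ℝ) (A : Set X) : Prop :=
  ∀ v : S, EMetric.diam {x ∈ A | 0 < f x v} ≤ ENNReal.ofReal K

/-- A family of subsets is `R`-disjoint if distinct members are at distance `> R`. -/
def RDisjointFam {X : Type*} [MetricSpace X] (R : ℝ) (𝒲 : Set (Set X)) : Prop :=
  ∀ U ∈ 𝒲, ∀ V ∈ 𝒲, U ≠ V → ∀ x ∈ U, ∀ y ∈ V, R < dist x y

/-- `𝒰` is uniformly bounded. -/
def UnifBounded {X : Type*} [MetricSpace X] (𝒰 : Set (Set X)) : Prop :=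
  ∃ M : ℝ, 0 < M ∧ ∀ U ∈ 𝒰, EMetric.diam U ≤ ENNReal.ofReal M

/-- `U` can be expressed as a union of at most `k` families from `𝒱` that are
`R`-disjoint. -/
def UnionOfFams {X : Type*} [MetricSpace X] (k : ℕ) (R : ℝ) (𝒱 : Set (Set X))
    (U : Set X) : Prop :=
  ∃ 𝒲 : Fin k → Set (Set X), (∀ j, 𝒲 j ⊆ 𝒱 ∧ RDisjointFam R (𝒲 j)) ∧
    U = ⋃ j, ⋃₀ 𝒲 j

/-- `X` is of countable asymptotic dimension (Definition 7.1). -/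
def CountableAsdim (X : Type*) [MetricSpace X] : Prop :=
  ∃ nseq : ℕ → ℕ, (∀ i, 1 ≤ nseq i) ∧
    ∀ R : ℕ → ℝ, (∀ i, 0 < R i) →
      ∃ 𝒱 : ℕ → Set (Set X), 𝒱 1 = {Set.univ} ∧
        (∀ i, 1 ≤ i → ∀ U ∈ 𝒱 i, UnionOfFams (nseq i) (R i) (𝒱 (i + 1)) U) ∧
        ∃ m, 1 ≤ m ∧ UnifBounded (𝒱 m)


/-- l1 norm of a finitely supported function -/
noncomputable def nrm {T : Type*} (φ : T →₀ ℝ) : ℝ := φ.sum fun _ a => |a|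

/-- finitely supported points of the skeleton -/
def DD {T : Type*} (n : ℕ∞) (φ : T →₀ ℝ) : Prop :=
  (∀ v, 0 ≤ φ v) ∧ (φ.sum fun _ a => a) = 1 ∧ (φ.support.card : ℕ∞) ≤ n + 1

def LipOn {X T : Type*} [MetricSpace X] (ε : ℝ) (f : X → T →₀ ℝ) (A : Set X) : Prop :=
  ∀ x ∈ A, ∀ y ∈ A, nrm (f x - f y) ≤ ε * dist x y + ε

section basic
variable {T T' : Type*}

lemma nrm_eq (φ : T →₀ ℝ) (s : Finset T) (h : φ.support ⊆ s) : nrm φ = ∑ v ∈ s, |φ v| := by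
  unfold nrm
  exact Finsupp.sum_of_support_subset _ h _ (by simp)

lemma tot_eq (φ : T →₀ ℝ) (s : Finset T) (h : φ.support ⊆ s) :
    (φ.sum fun _ a => a) = ∑ v ∈ s, φ v := by
  exact Finsupp.sum_of_support_subset _ h _ (by simp)

lemma nrm_zero : nrm (0 : T →₀ ℝ) = 0 := by simp [nrm]

lemma nrm_nonneg (φ : T →₀ ℝ) : 0 ≤ nrm φ := by
  unfold nrm Finsupp.sum; positivity

lemma nrm_add (φ ψ : T →₀ ℝ) : nrm (φ + ψ) ≤ nrm φ + nrm ψ := by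
  classical
  rw [nrm_eq (φ + ψ) (φ.support ∪ ψ.support) Finsupp.support_add,
    nrm_eq φ (φ.support ∪ ψ.support) Finset.subset_union_left,
    nrm_eq ψ (φ.support ∪ ψ.support) Finset.subset_union_right, ← Finset.sum_add_distrib]
  exact Finset.sum_le_sum fun v _ => by simpa using abs_add_le (φ v) (ψ v)

lemma nrm_smul (c : ℝ) (φ : T →₀ ℝ) : nrm (c • φ) = |c| * nrm φ := by
  classical
  rw [nrm_eq (c • φ) φ.support Finsupp.support_smul, nrm_eq φ φ.support subset_rfl,
    Finset.mul_sum]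
  simp [abs_mul]

lemma nrm_neg (φ : T →₀ ℝ) : nrm (-φ) = nrm φ := by
  have := nrm_smul (-1) φ
  simpa using this

lemma nrm_sub_comm (φ ψ : T →₀ ℝ) : nrm (φ - ψ) = nrm (ψ - φ) := by
  rw [← nrm_neg, neg_sub]

lemma nrm_sub (φ ψ : T →₀ ℝ) : nrm (φ - ψ) ≤ nrm φ + nrm ψ := by
  rw [sub_eq_add_neg, ← nrm_neg ψ]; exact nrm_add _ _

lemma nrm_single (v : T) (a : ℝ) : nrm (Finsupp.single v a) = |a| := by
  simp [nrm]

lemma abs_le_nrm (φ : T →₀ ℝ) (v : T) : |φ v| ≤ nrm φ := by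
  classical
  rw [nrm_eq φ (insert v φ.support) (Finset.subset_insert _ _)]
  exact Finset.single_le_sum (f := fun v => |φ v|) (fun _ _ => abs_nonneg _)
    (Finset.mem_insert_self _ _)

lemma nrm_mapDomain (e : T → T') (φ : T →₀ ℝ) : nrm (Finsupp.mapDomain e φ) ≤ nrm φ := by
  unfold Finsupp.mapDomain Finsupp.sum
  refine (Finset.le_sum_of_subadditive nrm nrm_zero.le nrm_add _ _).trans ?_
  simp only [nrm_single]
  exact le_rfl

lemma nrm_mapDomain_sub (e : T → T') (φ ψ : T →₀ ℝ) :
    nrm (Finsupp.mapDomain e φ - Finsupp.mapDomain e ψ) ≤ nrm (φ - ψ) := by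
  have : Finsupp.mapDomain e φ - Finsupp.mapDomain e ψ = Finsupp.mapDomain e (φ - ψ) := by
    have := (Finsupp.mapDomain.addMonoidHom (M := ℝ) e).map_sub φ ψ
    exact this.symm
  rw [this]; exact nrm_mapDomain _ _

lemma DD.nrm {n : ℕ∞} {φ : T →₀ ℝ} (h : DD n φ) : nrm φ = 1 := by
  rw [← h.2.1]
  exact Finset.sum_congr rfl fun v _ => abs_of_nonneg (h.1 v)

lemma DD.nrm_sub {n m : ℕ∞} {φ ψ : T →₀ ℝ} (h : DD n φ) (h' : DD m ψ) : _root_.nrm (φ - ψ) ≤ 2 := by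
  have := _root_.nrm_sub φ ψ
  rw [h.nrm, h'.nrm] at this
  linarith

lemma DD.mono {n m : ℕ∞} {φ : T →₀ ℝ} (h : DD n φ) (hnm : n ≤ m) : DD m φ :=
  ⟨h.1, h.2.1, h.2.2.trans (by gcongr)⟩

lemma DD.pos {n : ℕ∞} {φ : T →₀ ℝ} (h : DD n φ) {v : T} (hv : φ v ≠ 0) : 0 < φ v :=
  lt_of_le_of_ne (h.1 v) hv.symm

lemma DD.nonempty {n : ℕ∞} {φ : T →₀ ℝ} (h : DD n φ) : φ.support.Nonempty := by
  by_contra h0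
  have h1 := h.2.1
  rw [Finset.not_nonempty_iff_eq_empty] at h0
  simp [Finsupp.sum, h0] at h1

lemma mapDomain_nonneg {e : T → T'} {φ : T →₀ ℝ} (h : ∀ v, 0 ≤ φ v) (v : T') :
    0 ≤ Finsupp.mapDomain e φ v := by
  classical
  unfold Finsupp.mapDomain Finsupp.sum
  rw [Finsupp.finsetSum_apply]
  refine Finset.sum_nonneg fun i _ => ?_
  rw [Finsupp.single_apply]
  split_ifs
  · exact h i
  · exact le_rfl

lemma DD.mapDomain {n : ℕ∞} {φ : T →₀ ℝ} (h : DD n φ) (e : T → T') :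
    DD n (Finsupp.mapDomain e φ) := by
  classical
  refine ⟨mapDomain_nonneg h.1, ?_, ?_⟩
  · rw [Finsupp.sum_mapDomain_index (by simp) (by simp)]; exact h.2.1
  · refine le_trans ?_ h.2.2
    exact_mod_cast (Finset.card_le_card Finsupp.mapDomain_support).trans Finset.card_image_le

lemma exists_of_mapDomain_ne {e : T → T'} {φ : T →₀ ℝ} {s : T'}
    (h : Finsupp.mapDomain e φ s ≠ 0) : ∃ t, φ t ≠ 0 ∧ e t = s := by
  classical
  have := Finsupp.mapDomain_support (Finsupp.mem_support_iff.2 h)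
  simpa using this

lemma DD.single (n : ℕ∞) (v : T) : DD n (Finsupp.single v (1:ℝ)) := by
  classical
  refine ⟨fun w => ?_, by simp, ?_⟩
  · rw [Finsupp.single_apply]; split_ifs <;> norm_num
  · rw [Finsupp.support_single_ne_zero _ one_ne_zero]; simp

lemma tot_add (φ ψ : T →₀ ℝ) : ((φ + ψ).sum fun _ a => a) =
    (φ.sum fun _ a => a) + (ψ.sum fun _ a => a) :=
  Finsupp.sum_add_index' (by simp) (by simp)

lemma tot_smul (c : ℝ) (φ : T →₀ ℝ) : ((c • φ).sum fun _ a => a) =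
    c * (φ.sum fun _ a => a) := by
  rw [Finsupp.sum_smul_index' (by simp)]
  simp [Finsupp.sum, Finset.mul_sum]

lemma DD.conv {n : ℕ∞} {φ ψ : T →₀ ℝ} {t : ℝ} (h0 : 0 ≤ t) (h1 : t ≤ 1)
    (hφ : 0 < t → DD n φ) (hψ : t < 1 → DD n ψ) : DD (n + n + 1) (t • φ + (1 - t) • ψ) := by
  classical
  have hle : n ≤ n + n + 1 := by rw [add_assoc]; exact le_self_add
  rcases h0.eq_or_lt with rfl | h0
  · simpa using (hψ one_pos).mono hle
  rcases h1.eq_or_lt with rfl | h1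
  · simpa using (hφ one_pos).mono hle
  have hφ := hφ h0
  have hψ := hψ h1
  refine ⟨fun v => ?_, ?_, ?_⟩
  · have := hφ.1 v
    have := hψ.1 v
    have : 0 < 1 - t := by linarith
    simp only [Finsupp.add_apply, Finsupp.smul_apply, smul_eq_mul]
    positivity
  · rw [tot_add, tot_smul, tot_smul, hφ.2.1, hψ.2.1]; ring
  · have : (t • φ + (1 - t) • ψ).support ⊆ φ.support ∪ ψ.support :=
      Finsupp.support_add.trans
        (Finset.union_subset_union Finsupp.support_smul Finsupp.support_smul)
    have := (Finset.card_le_card this).trans (Finset.card_union_le _ _)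
    calc ((t • φ + (1 - t) • ψ).support.card : ℕ∞) ≤ (φ.support.card : ℕ∞) + ψ.support.card := by
          exact_mod_cast this
      _ ≤ (n + 1) + (n + 1) := add_le_add hφ.2.2 hψ.2.2
      _ = n + n + 1 + 1 := by ring

lemma conv_diff {n : ℕ∞} {φ ψ : T →₀ ℝ} {t s c : ℝ} (ht0 : 0 ≤ t) (ht1 : t ≤ 1)
    (hs0 : 0 ≤ s) (hc : 0 ≤ c)
    (hφ : 0 < t → DD n φ) (hψ : 0 < s → DD n ψ) (h : 0 < t → 0 < s → nrm (φ - ψ) ≤ c) :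
    nrm (t • φ - s • ψ) ≤ |t - s| + c := by
  rcases ht0.eq_or_lt with rfl | ht
  · rcases hs0.eq_or_lt with rfl | hs
    · simp [nrm_zero, hc]
    · simp [nrm_neg, nrm_smul, (hψ hs).nrm, hc]
  rcases hs0.eq_or_lt with rfl | hs
  · simp [nrm_smul, (hφ ht).nrm, hc]
  have e : t • φ - s • ψ = t • (φ - ψ) + (t - s) • ψ := by
    rw [smul_sub, sub_smul]; abel
  rw [e]
  refine (nrm_add _ _).trans ?_
  rw [nrm_smul, nrm_smul, (hψ hs).nrm, abs_of_pos ht]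
  have := h ht hs
  have := nrm_nonneg (φ - ψ)
  nlinarith

lemma l1dist_coe (φ ψ : T →₀ ℝ) : l1dist φ ψ = nrm (φ - ψ) := by
  unfold l1dist
  rw [nrm_eq (φ - ψ) _ subset_rfl, finsum_eq_sum_of_support_subset]
  · rfl
  · intro v hv
    simpa using hv

lemma isDeltaSkel_coe {n : ℕ∞} (φ : T →₀ ℝ) : IsDeltaSkel n φ ↔ DD n φ := by
  unfold IsDeltaSkel IsDelta DD
  have h1 : ∑ᶠ v, φ v = φ.sum fun _ a => a := by
    rw [finsum_eq_sum_of_support_subset (s := φ.support)]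
    · rfl
    · simp
  have h2 : (Function.support φ).encard = φ.support.card := by
    rw [← Set.encard_coe_eq_coe_finsetCard]; simp
  rw [h1, h2]
  simp [and_assoc]

lemma exists_coe {n : ℕ∞} {φ : T → ℝ} (h : IsDeltaSkel n φ) : ∃ ψ : T →₀ ℝ, φ = ψ :=
  ⟨Finsupp.ofSupportFinite φ h.1.2.1, rfl⟩

/-- moving a small coordinate -/
lemma exists_push {m : ℕ} {φ : T →₀ ℝ} {c : ℝ} (hc : 0 ≤ c)
    (h : DD ((m + 1 : ℕ) : ℕ∞) φ) (hs : φ.support.card ≤ m + 1 ∨ ∃ v ∈ φ.support, φ v < c) :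
    ∃ ψ : T →₀ ℝ, DD (m : ℕ∞) ψ ∧ ψ.support ⊆ φ.support ∧ nrm (ψ - φ) ≤ 2 * c := by
  classical
  by_cases hcard : φ.support.card ≤ m + 1
  · exact ⟨φ, ⟨h.1, h.2.1, by exact_mod_cast hcard⟩, subset_rfl, by simp [nrm_zero, hc]⟩
  obtain ⟨v, hv, hvc⟩ := hs.resolve_left hcard
  have : 1 < φ.support.card := by omega
  obtain ⟨w, hw, hwv⟩ := Finset.exists_mem_ne this v
  have hv0 := h.1 v
  have hsub : (φ + Finsupp.single w (φ v) - Finsupp.single v (φ v)).support ⊆ φ.support.erase v := by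
    intro t ht
    rw [Finsupp.mem_support_iff] at ht
    simp only [Finsupp.sub_apply, Finsupp.add_apply, Finsupp.single_apply] at ht
    rw [Finset.mem_erase]
    constructor
    · rintro rfl
      simp [hwv] at ht
    · by_cases htw : w = t
      · rwa [← htw]
      · by_cases htv : v = t
        · rwa [← htv]
        · simpa [htw, htv] using ht
  refine ⟨φ + Finsupp.single w (φ v) - Finsupp.single v (φ v), ⟨?_, ?_, ?_⟩,
    hsub.trans (Finset.erase_subset _ _), ?_⟩
  · intro t
    simp only [Finsupp.sub_apply, Finsupp.add_apply, Finsupp.single_apply]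
    have := h.1 t
    by_cases htv : v = t
    · subst htv; simp [hwv]
    · simp only [htv, if_false]
      split_ifs <;> linarith
  · have h1 := tot_add (φ + Finsupp.single w (φ v) - Finsupp.single v (φ v))
      (Finsupp.single v (φ v))
    rw [sub_add_cancel, tot_add, h.2.1] at h1
    simp at h1
    linarith
  · have h1 := Finset.card_le_card hsub
    rw [Finset.card_erase_of_mem hv] at h1
    have h2 : φ.support.card ≤ m + 1 + 1 := by exact_mod_cast h.2.2
    have h3 : (φ + Finsupp.single w (φ v) - Finsupp.single v (φ v)).support.card ≤ m + 1 := by omega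
    exact_mod_cast h3
  · have : φ + Finsupp.single w (φ v) - Finsupp.single v (φ v) - φ =
      Finsupp.single w (φ v) - Finsupp.single v (φ v) := by abel
    rw [this]
    refine (nrm_sub _ _).trans ?_
    rw [nrm_single, nrm_single, abs_of_nonneg hv0]; linarith

end basic

section main
variable {X : Type u} [MetricSpace X]

/-- Carrier-preserving push into the `n`-skeleton. -/
def PushTo (X : Type u) [MetricSpace X] (n m : ℕ∞) : Prop :=
  ∀ ε > (0:ℝ), ∃ δ > (0:ℝ), ∀ (T : Type u) (Y : Set X) (F : X → T →₀ ℝ),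
    (∀ x ∈ Y, DD m (F x)) → LipOn δ F Y →
    ∃ G : X → T →₀ ℝ, (∀ x ∈ Y, DD n (G x) ∧ (G x).support ⊆ (F x).support) ∧ LipOn ε G Y

def Extensor (X : Type u) [MetricSpace X] (n : ℕ∞) : Prop :=
  ∀ ε > (0:ℝ), ∃ δ > (0:ℝ), ∀ (T : Type u) (σ : Finset T) (A : Set X) (f : X → T →₀ ℝ),
    σ.Nonempty → (∀ x ∈ A, DD n (f x) ∧ (f x).support ⊆ σ) → LipOn δ f A →
    ∃ g : X → T →₀ ℝ, (∀ a ∈ A, g a = f a) ∧ (∀ x, DD n (g x) ∧ (g x).support ⊆ σ) ∧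
      LipOn ε g Set.univ

lemma extensor_of [Infinite X] (n : ℕ∞)
    (hext : ∀ ε > (0:ℝ), ∃ δ > (0:ℝ), ∀ (A : Set X) (f : X → X → ℝ),
      PartUnitySkelOn n f A → LipschitzEpsOn δ f A →
      ∃ g : X → X → ℝ, (∀ a ∈ A, g a = f a) ∧ PartUnitySkelOn n g Set.univ ∧
        LipschitzEpsOn ε g Set.univ) : Extensor X n := by
  classical
  intro ε hε
  obtain ⟨δ, hδ, H⟩ := hext ε hε
  refine ⟨δ, hδ, fun T σ A f hσ hf hlip => ?_⟩
  obtain ⟨t0, ht0⟩ := hσ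
  let emb : σ ↪ X := (σ.equivFin.toEmbedding).trans (Fin.valEmbedding.trans (Infinite.natEmbedding X))
  let e : T → X := fun t => if h : t ∈ σ then emb ⟨t, h⟩ else emb ⟨t0, ht0⟩
  let ρ : X → T := fun x => if h : ∃ s : σ, emb s = x then (h.choose : T) else t0
  have hρσ : ∀ x, ρ x ∈ σ := by
    intro x
    by_cases h : ∃ s : σ, emb s = x
    · simp only [ρ, dif_pos h]; exact h.choose.2
    · simp only [ρ, dif_neg h]; exact ht0
  have hρe : ∀ t ∈ σ, ρ (e t) = t := by
    intro t ht
    have h : ∃ s : σ, emb s = e t := ⟨⟨t, ht⟩, by simp [e, ht]⟩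
    have h2 : h.choose = ⟨t, ht⟩ := emb.injective (by rw [h.choose_spec]; simp [e, ht])
    simp only [ρ, dif_pos h, h2]
  obtain ⟨g, hg1, hg2, hg3⟩ := H A (fun x => Finsupp.mapDomain e (f x))
    (fun x hx => (isDeltaSkel_coe _).2 ((hf x hx).1.mapDomain e))
    (fun x hx y hy => by
      rw [l1dist_coe]; exact (nrm_mapDomain_sub _ _ _).trans (hlip x hx y hy))
  choose g' hg' using fun x => exists_coe (hg2 x (Set.mem_univ x))
  refine ⟨fun x => Finsupp.mapDomain ρ (g' x), fun a ha => ?_, fun x => ⟨?_, ?_⟩, ?_⟩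
  · have : g' a = Finsupp.mapDomain e (f a) := by
      apply DFunLike.coe_injective
      rw [← hg' a, hg1 a ha]
    simp only [this]
    rw [← Finsupp.mapDomain_comp]
    conv_rhs => rw [← Finsupp.mapDomain_id (v := f a)]
    apply Finsupp.mapDomain_congr
    intro t ht
    exact hρe t ((hf a ha).2 ht)
  · refine DD.mapDomain ((isDeltaSkel_coe _).1 ?_) ρ
    rw [← hg' x]; exact hg2 x (Set.mem_univ x)
  · intro t ht
    obtain ⟨s, -, rfl⟩ := exists_of_mapDomain_ne (Finsupp.mem_support_iff.1 ht)
    exact hρσ s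
  · intro x hx y hy
    refine (nrm_mapDomain_sub _ _ _).trans ?_
    rw [← l1dist_coe, ← hg' x, ← hg' y]
    exact hg3 x hx y hy

lemma push_succ {n m : ℕ} (hE : Extensor X n) (hP : PushTo X n m) :
    PushTo X n ((m + 1 : ℕ) : ℕ∞) := by
  classical
  intro ε hε
  obtain ⟨δ0, hδ0, hE⟩ := hE ε hε
  obtain ⟨δ1, hδ1, hP⟩ := hP (min δ0 ε) (by positivity)
  have hcpos : 0 < δ1 / 8 := by positivity
  set c := δ1 / 8 with hc
  refine ⟨min (δ1 / 2) (c * ε / 2), by positivity, fun T Y F hF hlip => ?_⟩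
  set δ := min (δ1 / 2) (c * ε / 2) with hδ
  have hδa : δ ≤ δ1 / 2 := min_le_left _ _
  have hδb : δ ≤ c * ε / 2 := min_le_right _ _
  have hδpos : 0 < δ := by positivity
  let Y' : Set X := {x ∈ Y | (F x).support.card ≤ m + 1 ∨ ∃ v ∈ (F x).support, F x v < c}
  have h1 : ∀ x, ∃ ψ : T →₀ ℝ, x ∈ Y' →
      DD (m : ℕ∞) ψ ∧ ψ.support ⊆ (F x).support ∧ nrm (ψ - F x) ≤ 2 * c := by
    intro x
    by_cases hx : x ∈ Y'
    · obtain ⟨ψ, h⟩ := exists_push hcpos.le (hF x hx.1) hx.2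
      exact ⟨ψ, fun _ => h⟩
    · exact ⟨0, fun h => absurd h hx⟩
  choose F' hF' using h1
  obtain ⟨G', hG', hG'lip⟩ := hP T Y' F' (fun x hx => (hF' x hx).1) (by
    intro x hx y hy
    have e : F' x - F' y = (F' x - F x) + ((F x - F y) + (F y - F' y)) := by abel
    rw [e]
    have a1 := nrm_add (F' x - F x) ((F x - F y) + (F y - F' y))
    have a2 := nrm_add (F x - F y) (F y - F' y)
    have a3 := (hF' x hx).2.2
    have a4 := (hF' y hy).2.2
    rw [nrm_sub_comm] at a4
    have a5 := hlip x hx.1 y hy.1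
    have d0 : 0 ≤ dist x y := dist_nonneg
    have : δ * dist x y ≤ δ1 * dist x y := by gcongr; linarith
    linarith)
  have h2 : ∀ σ : Finset T, ∃ g : X → T →₀ ℝ, σ.Nonempty →
      (∀ a ∈ Y', (F a).support = σ → g a = G' a) ∧
      (∀ x, DD n (g x) ∧ (g x).support ⊆ σ) ∧ LipOn ε g Set.univ := by
    intro σ
    by_cases hσ : σ.Nonempty
    · obtain ⟨g, hg1, hg2, hg3⟩ := hE T σ {x ∈ Y' | (F x).support = σ} G' hσ
        (fun x hx => ⟨(hG' x hx.1).1, by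
          rw [← hx.2]; exact (hG' x hx.1).2.trans (hF' x hx.1).2.1⟩)
        (fun x hx y hy => (hG'lip x hx.1 y hy.1).trans (by
          have : min δ0 ε ≤ δ0 := min_le_left _ _
          have d0 : 0 ≤ dist x y := dist_nonneg
          gcongr))
      exact ⟨g, fun _ => ⟨fun a ha h => hg1 a ⟨ha, h⟩, hg2, hg3⟩⟩
    · exact ⟨0, fun h => absurd h hσ⟩
  choose g hg using h2
  have hgF : ∀ x ∈ Y, _ := fun x hx => hg (F x).support (hF x hx).nonempty
  let G : X → T →₀ ℝ := fun x => if x ∈ Y' then G' x else g (F x).support x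
  have hG : ∀ x ∈ Y, G x = g (F x).support x := by
    intro x hx
    by_cases hx' : x ∈ Y'
    · simp only [G, if_pos hx']
      exact ((hgF x hx).1 x hx' rfl).symm
    · simp only [G, if_neg hx']
  have hGD : ∀ x ∈ Y, DD n (G x) ∧ (G x).support ⊆ (F x).support := by
    intro x hx
    rw [hG x hx]
    exact (hgF x hx).2.1 x
  have far : ∀ x ∈ Y, ∀ y ∈ Y, x ∉ Y' → (F x).support ≠ (F y).support →
      nrm (G x - G y) ≤ ε * dist x y + ε := by
    intro x hx y hy hx' hne
    have hx2 : ¬ ((F x).support.card ≤ m + 1 ∨ ∃ v ∈ (F x).support, F x v < c) :=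
      fun h => hx' ⟨hx, h⟩
    push Not at hx2
    have hy2 : (F y).support.card ≤ m + 1 + 1 := by exact_mod_cast (hF y hy).2.2
    have : ¬ (F x).support ⊆ (F y).support := fun h =>
      hne (Finset.eq_of_subset_of_card_le h (by omega))
    obtain ⟨v, hv, hvy⟩ := Finset.not_subset.1 this
    have b1 := hx2.2 v hv
    have b2 : F y v = 0 := by simpa using hvy
    have b3 := abs_le_nrm (F x - F y) v
    rw [Finsupp.sub_apply, b2, sub_zero] at b3
    have b4 := le_abs_self (F x v)
    have b5 := hlip x hx y hy
    have b6 : c ≤ δ * (dist x y + 1) := by linarith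
    have d0 : 0 ≤ dist x y := dist_nonneg
    have b7 : c ≤ c * ε / 2 * (dist x y + 1) := b6.trans (by gcongr)
    have b8 : 2 ≤ ε * (dist x y + 1) := by
      by_contra hcon
      push Not at hcon
      nlinarith
    have := (hGD x hx).1.nrm_sub (hGD y hy).1
    linarith
  refine ⟨G, hGD, ?_⟩
  intro x hx y hy
  by_cases hs : (F x).support = (F y).support
  · rw [hG x hx, hG y hy, ← hs]
    exact (hgF x hx).2.2 x trivial y trivial
  by_cases hx' : x ∈ Y'
  · by_cases hy' : y ∈ Y'
    · simp only [G, if_pos hx', if_pos hy']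
      refine (hG'lip x hx' y hy').trans ?_
      have : min δ0 ε ≤ ε := min_le_right _ _
      have d0 : 0 ≤ dist x y := dist_nonneg
      gcongr
    · rw [nrm_sub_comm, dist_comm]
      exact far y hy x hx hy' (Ne.symm hs)
  · exact far x hx y hy hx' hs

lemma push_of_le {n m : ℕ∞} (h : m ≤ n) : PushTo X n m := fun ε hε =>
  ⟨ε, hε, fun _ _ F hF hl => ⟨F, fun x hx => ⟨(hF x hx).mono h, subset_rfl⟩, hl⟩⟩

lemma push_all {n : ℕ} (hE : Extensor X n) (m : ℕ) (h : n ≤ m) : PushTo X n m := by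
  induction m, h using Nat.le_induction with
  | base => exact push_of_le le_rfl
  | succ m hm ih =>
    exact push_succ hE ih

lemma push_main {n : ℕ∞} (hE : Extensor X n) : PushTo X n (n + n + 1) := by
  induction n using ENat.recTopCoe with
  | top => exact push_of_le le_top
  | coe n => exact_mod_cast push_all hE (n + n + 1) (by omega)

/-- `U` admits a `(δ,δ)`-Lipschitz `K`-cobounded partition of unity. -/
def Good (n : ℕ∞) (δ K : ℝ) (U : Set X) : Prop :=
  ∃ (T : Type u) (f : X → T →₀ ℝ), (∀ x ∈ U, DD n (f x)) ∧ LipOn δ f U ∧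
    ∀ v, ∀ x ∈ U, ∀ y ∈ U, 0 < f x v → 0 < f y v → dist x y ≤ K

lemma Good.mono {n : ℕ∞} {δ δ' K K' : ℝ} {U : Set X} (h : Good n δ K U) (hδ : δ ≤ δ')
    (hK : K ≤ K') : Good n δ' K' U := by
  obtain ⟨T, f, h1, h2, h3⟩ := h
  refine ⟨T, f, h1, fun x hx y hy => (h2 x hx y hy).trans ?_,
    fun v x hx y hy a b => (h3 v x hx y hy a b).trans hK⟩
  have d0 : 0 ≤ dist x y := dist_nonneg
  gcongr

lemma good_empty (n : ℕ∞) (δ K : ℝ) : Good n δ K (∅ : Set X) :=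
  ⟨PUnit, 0, by simp, by simp [LipOn], by simp⟩

lemma merge {n : ℕ∞} (hP : PushTo X n (n + n + 1)) : ∀ ε > (0:ℝ), ∃ δ > (0:ℝ), ∀ K : ℝ,
    ∃ K' : ℝ, ∀ A B : Set X, Good n δ K A → Good n δ K B → Good n ε K' (A ∪ B) := by
  classical
  intro ε hε
  obtain ⟨δ1, hδ1, hP⟩ := hP ε hε
  have hr : 0 < 4 / δ1 := by positivity
  have hrd : 2 * (1 / (4 / δ1)) = δ1 / 2 := by field_simp; norm_num
  set r := 4 / δ1 with hrdef
  have hδle : δ1 / (2 * r + 4) ≤ δ1 / 4 := by gcongr; linarith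
  have hδeq : δ1 / (2 * r + 4) * (2 * r + 4) = δ1 := by field_simp
  have hδpos : 0 < δ1 / (2 * r + 4) := by positivity
  set δ := δ1 / (2 * r + 4) with hδ
  refine ⟨min δ ε, by positivity, fun K => ⟨K + 2 * r, fun A B hA hB => ?_⟩⟩
  rcases A.eq_empty_or_nonempty with rfl | hne
  · rw [Set.empty_union]
    exact hB.mono (min_le_right _ _) (by linarith)
  obtain ⟨T1, f1, h11, h12, h13⟩ := hA.mono (min_le_left _ _) le_rfl
  obtain ⟨T2, f2, h21, h22, h23⟩ := hB.mono (min_le_left _ _) le_rfl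
  let t : X → ℝ := fun x => max 0 (1 - Metric.infDist x A / r)
  have t0 : ∀ x, 0 ≤ t x := fun x => le_max_left _ _
  have t1 : ∀ x, t x ≤ 1 := fun x => max_le zero_le_one (by
    have : 0 ≤ Metric.infDist x A / r := div_nonneg Metric.infDist_nonneg hr.le
    linarith)
  have tA : ∀ x ∈ A, t x = 1 := fun x hx => by
    simp [t, Metric.infDist_zero_of_mem hx]
  have tlip : ∀ x y, |t x - t y| ≤ 1 / r * dist x y := by
    intro x y
    have a1 := abs_max_sub_max_le_abs (1 - Metric.infDist x A / r) (1 - Metric.infDist y A / r) 0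
    rw [max_comm _ (0:ℝ), max_comm _ (0:ℝ)] at a1
    refine a1.trans ?_
    have a2 : |Metric.infDist y A - Metric.infDist x A| ≤ dist x y := by
      rw [abs_le]
      have b1 := Metric.infDist_le_infDist_add_dist (s := A) (x := x) (y := y)
      have b2 := Metric.infDist_le_infDist_add_dist (s := A) (x := y) (y := x)
      rw [dist_comm y x] at b2
      constructor <;> linarith
    have : 1 - Metric.infDist x A / r - (1 - Metric.infDist y A / r) =
      1 / r * (Metric.infDist y A - Metric.infDist x A) := by ring
    rw [this, abs_mul, abs_of_pos (by positivity : 0 < 1 / r)]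
    gcongr
  have ha : ∀ x, ∃ a, 0 < t x → a ∈ A ∧ dist x a < r := by
    intro x
    by_cases hx : 0 < t x
    · have : Metric.infDist x A < r := by
        have := (lt_max_iff.1 hx).resolve_left (lt_irrefl _)
        have h' : Metric.infDist x A / r < 1 := by linarith
        rwa [div_lt_one hr] at h'
      obtain ⟨a, ha, hd⟩ := (Metric.infDist_lt_iff hne).1 this
      exact ⟨a, fun _ => ⟨ha, hd⟩⟩
    · exact ⟨x, fun h => absurd h hx⟩
  choose a ha using ha
  have tB : ∀ x ∈ A ∪ B, t x < 1 → x ∈ B := fun x hx h => hx.resolve_left fun hA => by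
    rw [tA x hA] at h; exact lt_irrefl _ h
  let F1 : X → (T1 ⊕ T2) →₀ ℝ := fun x => Finsupp.mapDomain Sum.inl (f1 (a x))
  let F2 : X → (T1 ⊕ T2) →₀ ℝ := fun x => Finsupp.mapDomain Sum.inr (f2 x)
  let F : X → (T1 ⊕ T2) →₀ ℝ := fun x => t x • F1 x + (1 - t x) • F2 x
  have hF1 : ∀ x, 0 < t x → DD n (F1 x) := fun x hx => (h11 _ (ha x hx).1).mapDomain _
  have hF2 : ∀ x ∈ A ∪ B, t x < 1 → DD n (F2 x) := fun x hx h => (h21 _ (tB x hx h)).mapDomain _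
  obtain ⟨G, hG1, hG2⟩ := hP (T1 ⊕ T2) (A ∪ B) F
    (fun x hx => DD.conv (t0 x) (t1 x) (hF1 x) (hF2 x hx)) (by
    intro x hx y hy
    have d0 : 0 ≤ dist x y := dist_nonneg
    have e : F x - F y = (t x • F1 x - t y • F1 y) + ((1 - t x) • F2 x - (1 - t y) • F2 y) := by
      simp only [F]; abel
    rw [e]
    refine (nrm_add _ _).trans ?_
    have c1 := conv_diff (n := n) (φ := F1 x) (ψ := F1 y) (c := δ * (dist x y + 2 * r) + δ)
      (t0 x) (t1 x) (t0 y) (by positivity) (hF1 x) (hF1 y) (by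
        intro hx' hy'
        obtain ⟨p1, p2⟩ := ha x hx'
        obtain ⟨q1, q2⟩ := ha y hy'
        refine (nrm_mapDomain_sub _ _ _).trans ((h12 _ p1 _ q1).trans ?_)
        have := dist_triangle4 (a x) x y (a y)
        rw [dist_comm (a x) x] at this
        gcongr
        linarith)
    have c2 := conv_diff (n := n) (φ := F2 x) (ψ := F2 y) (t := 1 - t x) (s := 1 - t y)
      (c := δ * dist x y + δ)
      (by linarith [t1 x]) (by linarith [t0 x]) (by linarith [t1 y]) (by positivity)
      (fun h => hF2 x hx (by linarith)) (fun h => hF2 y hy (by linarith)) (by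
        intro hx' hy'
        exact (nrm_mapDomain_sub _ _ _).trans
          (h22 _ (tB x hx (by linarith)) _ (tB y hy (by linarith))))
    have e2 : 1 - t x - (1 - t y) = -(t x - t y) := by ring
    rw [e2, abs_neg] at c2
    have c3 := tlip x y
    have c4 : 2 * (1 / r * dist x y) = δ1 / 2 * dist x y := by rw [← hrd]; ring
    have c5 : δ * dist x y ≤ δ1 / 4 * dist x y := by gcongr
    nlinarith)
  refine ⟨T1 ⊕ T2, G, fun x hx => (hG1 x hx).1, hG2, ?_⟩
  have key : ∀ v, ∀ x ∈ A ∪ B, 0 < G x v → F x v ≠ 0 := fun v x hx h =>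
    Finsupp.mem_support_iff.1 ((hG1 x hx).2 (Finsupp.mem_support_iff.2 h.ne'))
  rintro (v | v) x hx y hy hvx hvy
  · have k : ∀ x ∈ A ∪ B, 0 < G x (Sum.inl v) → 0 < t x ∧ 0 < f1 (a x) v := by
      intro x hx h
      have h' := key _ x hx h
      have e1 : F1 x (Sum.inl v) = f1 (a x) v :=
        Finsupp.mapDomain_apply Sum.inl_injective _ _
      have e2 : F2 x (Sum.inl v) = 0 := Finsupp.mapDomain_notin_range _ _ (by simp)
      simp only [F, Finsupp.add_apply, Finsupp.smul_apply, e1, e2, smul_eq_mul, mul_zero,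
        add_zero] at h'
      have ht : 0 < t x := lt_of_le_of_ne (t0 x) (left_ne_zero_of_mul h').symm
      exact ⟨ht, (h11 _ (ha x ht).1).pos (right_ne_zero_of_mul h')⟩
    obtain ⟨p1, p2⟩ := k x hx hvx
    obtain ⟨q1, q2⟩ := k y hy hvy
    have := h13 v _ (ha x p1).1 _ (ha y q1).1 p2 q2
    have h3 := dist_triangle4 x (a x) (a y) y
    rw [dist_comm (a y) y] at h3
    linarith [(ha x p1).2, (ha y q1).2]
  · have k : ∀ x ∈ A ∪ B, 0 < G x (Sum.inr v) → x ∈ B ∧ 0 < f2 x v := by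
      intro x hx h
      have h' := key _ x hx h
      have e1 : F2 x (Sum.inr v) = f2 x v :=
        Finsupp.mapDomain_apply Sum.inr_injective _ _
      have e2 : F1 x (Sum.inr v) = 0 := Finsupp.mapDomain_notin_range _ _ (by simp)
      simp only [F, Finsupp.add_apply, Finsupp.smul_apply, e1, e2, smul_eq_mul, mul_zero,
        zero_add] at h'
      have ht : t x < 1 := lt_of_le_of_ne (t1 x) (fun hh => left_ne_zero_of_mul h' (by rw [hh, sub_self]))
      exact ⟨tB x hx ht, (h21 _ (tB x hx ht)).pos (right_ne_zero_of_mul h')⟩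
    obtain ⟨p1, p2⟩ := k x hx hvx
    obtain ⟨q1, q2⟩ := k y hy hvy
    have := h23 v _ p1 _ q1 p2 q2
    linarith

lemma mergeK {n : ℕ∞} (hP : PushTo X n (n + n + 1)) (k : ℕ) : ∀ ε > (0:ℝ), ∃ δ > (0:ℝ), ∀ K : ℝ,
    ∃ K' : ℝ, ∀ A : Fin k → Set X, (∀ j, Good n δ K (A j)) → Good n ε K' (⋃ j, A j) := by
  induction k with
  | zero =>
    intro ε hε
    refine ⟨1, one_pos, fun K => ⟨0, fun A _ => ?_⟩⟩
    rw [Set.iUnion_of_empty]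
    exact good_empty _ _ _
  | succ k ih =>
    intro ε hε
    obtain ⟨δ1, hδ1, h1⟩ := merge hP ε hε
    obtain ⟨δ2, hδ2, h2⟩ := ih δ1 hδ1
    refine ⟨min δ1 δ2, by positivity, fun K => ?_⟩
    obtain ⟨K2, h2⟩ := h2 K
    obtain ⟨K1, h1⟩ := h1 (max K K2)
    refine ⟨K1, fun A hA => ?_⟩
    have e : (⋃ j, A j) = A 0 ∪ ⋃ j : Fin k, A j.succ := by
      ext x; simp [Fin.exists_fin_succ]
    rw [e]
    exact h1 _ _ ((hA 0).mono (min_le_left _ _) (le_max_left _ _))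
      ((h2 _ fun j => (hA j.succ).mono (min_le_right _ _) le_rfl).mono le_rfl (le_max_right _ _))

lemma glue {n : ℕ∞} {δ K R : ℝ} (hδ : 0 < δ) (hR : 2 / δ ≤ R) (W : Set (Set X))
    (hW : RDisjointFam R W) (h : ∀ U ∈ W, Good n δ K U) : Good n δ K (⋃₀ W) := by
  classical
  rcases W.eq_empty_or_nonempty with rfl | ⟨U0, hU0⟩
  · rw [Set.sUnion_empty]; exact good_empty _ _ _
  choose T f h1 h2 h3 using fun U : W => h U.1 U.2
  have hu : ∀ x, ∃ U : W, x ∈ ⋃₀ W → x ∈ U.1 := by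
    intro x
    by_cases hx : x ∈ ⋃₀ W
    · obtain ⟨U, hU, hxU⟩ := hx
      exact ⟨⟨U, hU⟩, fun _ => hxU⟩
    · exact ⟨⟨U0, hU0⟩, fun h => absurd h hx⟩
  choose w hw using hu
  have hD : ∀ x ∈ ⋃₀ W, DD n (Finsupp.mapDomain (Sigma.mk (w x)) (f (w x) x) : (Σ U, T U) →₀ ℝ) :=
    fun x hx => (h1 _ x (hw x hx)).mapDomain _
  refine ⟨Σ U : W, T U, fun x => Finsupp.mapDomain (Sigma.mk (w x)) (f (w x) x), hD, ?_, ?_⟩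
  · intro x hx y hy
    by_cases hxy : w x = w y
    · have hx' := hw x hx
      have hy' := hw y hy
      simp only
      rw [← hxy] at hy' ⊢
      exact (nrm_mapDomain_sub _ _ _).trans (h2 _ x hx' y hy')
    · have hd := hW _ (w x).2 _ (w y).2 (fun h => hxy (Subtype.ext h)) x (hw x hx) y (hw y hy)
      have h4 := (hD x hx).nrm_sub (hD y hy)
      have h5 : 2 / δ ≤ dist x y := hR.trans hd.le
      rw [div_le_iff₀ hδ] at h5
      refine h4.trans ?_
      linarith
  · rintro ⟨U, v⟩ x hx y hy hvx hvy
    have k : ∀ x ∈ ⋃₀ W, 0 < (Finsupp.mapDomain (Sigma.mk (w x)) (f (w x) x) : (Σ U, T U) →₀ ℝ) ⟨U, v⟩ →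
        x ∈ U.1 ∧ 0 < f U x v := by
      intro x hx hpos
      obtain ⟨s, hs, he⟩ := exists_of_mapDomain_ne hpos.ne'
      have hx' := hw x hx
      generalize w x = U' at *
      cases he
      exact ⟨hx', (h1 _ x hx').pos hs⟩
    obtain ⟨p1, p2⟩ := k x hx hvx
    obtain ⟨q1, q2⟩ := k y hy hvy
    exact h3 U v x p1 y q1 p2 q2

lemma step {n : ℕ∞} (hP : PushTo X n (n + n + 1)) (k : ℕ) (ε : ℝ) (hε : 0 < ε) :
    ∃ δ R : ℝ, 0 < δ ∧ 0 < R ∧ ∀ K : ℝ, ∃ K' : ℝ, ∀ 𝒱 : Set (Set X), (∀ V ∈ 𝒱, Good n δ K V) →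
      ∀ U, UnionOfFams k R 𝒱 U → Good n ε K' U := by
  obtain ⟨δ, hδ, h⟩ := mergeK hP k ε hε
  refine ⟨δ, 2 / δ, hδ, by positivity, fun K => ?_⟩
  obtain ⟨K', h⟩ := h K
  refine ⟨K', fun 𝒱 hV U hU => ?_⟩
  obtain ⟨W, hW, rfl⟩ := hU
  exact h _ fun j => glue hδ le_rfl _ (hW j).2 fun U hU => hV U ((hW j).1 hU)

lemma good_of_diam (n : ℕ∞) {δ K : ℝ} (hδ : 0 < δ) (hK : 0 < K) {U : Set X}
    (h : Metric.ediam U ≤ ENNReal.ofReal K) : Good n δ K U := by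
  refine ⟨PUnit, fun _ => Finsupp.single PUnit.unit 1, fun x _ => DD.single _ _, ?_, ?_⟩
  · intro x _ y _
    rw [sub_self, nrm_zero]
    positivity
  · intro v x hx y hy _ _
    have := (Metric.edist_le_ediam_of_mem hx hy).trans h
    rw [edist_dist] at this
    exact (ENNReal.ofReal_le_ofReal_iff hK.le).1 this

lemma good_univ {n : ℕ∞} (hP : PushTo X n (n + n + 1)) (hcad : CountableAsdim X) (ε : ℝ)
    (hε : 0 < ε) : ∃ K, Good n ε K (Set.univ : Set X) := by
  obtain ⟨ns, -, H⟩ := hcad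
  choose! δf Rf hδf hRf hstep using step hP
  let E : ℕ → ℝ := fun j => Nat.rec ε (fun j e => δf (ns (j + 1)) e) j
  have E0 : E 0 = ε := rfl
  have Es : ∀ j, E (j + 1) = δf (ns (j + 1)) (E j) := fun j => rfl
  have Epos : ∀ j, 0 < E j := by
    intro j
    induction j with
    | zero => exact hε
    | succ j ih => rw [Es]; exact hδf _ _ ih
  obtain ⟨𝒱, hV1, hV, m, hm, M, hM, hb⟩ := H (fun i => Rf (ns i) (E (i - 1)))
    (fun i => hRf _ _ (Epos _))
  obtain ⟨m, rfl⟩ : ∃ j, m = j + 1 := ⟨m - 1, by omega⟩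
  have main : ∀ j ≤ m, ∃ K, ∀ U ∈ 𝒱 (m - j + 1), Good n (E (m - j)) K U := by
    intro j
    induction j with
    | zero => exact fun _ => ⟨M, fun U hU => good_of_diam n (Epos _) hM (hb U hU)⟩
    | succ j ih =>
      intro hj
      obtain ⟨K, hK⟩ := ih (by omega)
      obtain ⟨i, hi⟩ : ∃ i, i = m - (j + 1) := ⟨_, rfl⟩
      have hi' : m - j = i + 1 := by omega
      rw [← hi]
      rw [hi'] at hK
      obtain ⟨K', hK'⟩ := hstep (ns (i + 1)) (E i) (Epos i) K
      exact ⟨K', fun U hU => hK' _ hK U (hV (i + 1) (by omega) U hU)⟩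
  obtain ⟨K, hK⟩ := main m le_rfl
  rw [Nat.sub_self] at hK
  exact ⟨K, hK _ (by rw [hV1]; rfl)⟩

lemma relabel {n : ℕ∞} {ε K : ℝ} (h : Good n ε K (Set.univ : Set X)) (S : Type u)
    (hS : Cardinal.mk (X × ℕ) < Cardinal.mk S) :
    ∃ g : X → S → ℝ, PartUnitySkelOn n g Set.univ ∧ LipschitzEpsOn ε g Set.univ ∧
        ∃ K : ℝ, 0 < K ∧ CoboundedOn K g Set.univ := by
  classical
  obtain ⟨T, f, h1, h2, h3⟩ := h
  let Q : Set T := ⋃ x, ((f x).support : Set T)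
  have hQ : Cardinal.mk Q ≤ Cardinal.mk S := by
    refine le_trans ?_ hS.le
    refine (Cardinal.mk_iUnion_le_sum_mk).trans ?_
    have : Cardinal.mk (X × ℕ) = Cardinal.sum (fun _ : X => Cardinal.aleph0.{u}) := by simp
    rw [this]
    refine Cardinal.sum_le_sum _ _ fun x => ?_
    exact (Cardinal.lt_aleph0_of_finite _).le
  obtain ⟨emb⟩ := hQ
  have hSne : Nonempty S := by
    rw [← Cardinal.mk_ne_zero_iff]
    exact (lt_of_le_of_lt (zero_le) hS).ne'
  obtain ⟨s0⟩ := hSne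
  let e : T → S := fun t => if h : t ∈ Q then emb ⟨t, h⟩ else s0
  have he : ∀ t ∈ Q, ∀ t' ∈ Q, e t = e t' → t = t' := by
    intro t ht t' ht' h
    simp only [e, dif_pos ht, dif_pos ht'] at h
    exact congrArg Subtype.val (emb.injective h)
  refine ⟨fun x => Finsupp.mapDomain e (f x), fun x hx => (isDeltaSkel_coe _).2
    ((h1 x hx).mapDomain e), fun x hx y hy => ?_, max K 1, by positivity, fun v => ?_⟩
  · rw [l1dist_coe]
    exact (nrm_mapDomain_sub _ _ _).trans (h2 x hx y hy)
  · refine Metric.ediam_le ?_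
    rintro x ⟨hx, hvx⟩ y ⟨hy, hvy⟩
    obtain ⟨t, ht, rfl⟩ := exists_of_mapDomain_ne hvx.ne'
    obtain ⟨t', ht', hee⟩ := exists_of_mapDomain_ne hvy.ne'
    have : t' = t := he _ (Set.mem_iUnion.2 ⟨y, by simpa using ht'⟩) _
      (Set.mem_iUnion.2 ⟨x, by simpa using ht⟩) hee
    subst this
    rw [edist_dist]
    exact ENNReal.ofReal_le_ofReal ((h3 _ x hx y hy ((h1 x hx).pos ht)
      ((h1 y hy).pos ht')).trans (le_max_left _ _))

lemma good_finite [Finite X] (n : ℕ∞) {ε : ℝ} (hε : 0 < ε) :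
    ∃ K, Good n ε K (Set.univ : Set X) := by
  have hb := (Set.finite_univ (α := X)).isBounded
  obtain ⟨C, hC⟩ := Metric.isBounded_iff.1 hb
  refine ⟨C, PUnit, fun _ => Finsupp.single PUnit.unit 1, fun x _ => DD.single _ _, ?_, ?_⟩
  · intro x _ y _
    rw [sub_self, nrm_zero]
    positivity
  · intro v x hx y hy _ _
    exact hC hx hy

end main

/-- Theorem 7.6. Suppose `Δ(X)⁽ⁿ⁾` is a large scale absolute extensor
of `X`: for every `ε > 0` there is `δ > 0` such that every `(δ,δ)`-Lipschitz map
`f : A → Δ(X)⁽ⁿ⁾`, `A ⊆ X`, extends to an `(ε,ε)`-Lipschitz map `g : X → Δ(X)⁽ⁿ⁾`.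
If `X` is of countable asymptotic dimension, then for every set `S` of cardinality bigger
than `card(X × ℕ)` and every `ε > 0` there is an `(ε,ε)`-Lipschitz partition of unity
`g : X → Δ(S)⁽ⁿ⁾` that is `K`-cobounded for some `K > 0`. -/
theorem stmt14 {X : Type u} [MetricSpace X] (n : ℕ∞)
    (hext : ∀ ε > (0:ℝ), ∃ δ > (0:ℝ), ∀ (A : Set X) (f : X → X → ℝ),
      PartUnitySkelOn n f A → LipschitzEpsOn δ f A →
      ∃ g : X → X → ℝ, (∀ a ∈ A, g a = f a) ∧ PartUnitySkelOn n g Set.univ ∧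
        LipschitzEpsOn ε g Set.univ)
    (hcad : CountableAsdim X) :
    ∀ S : Type u, Cardinal.mk (X × ℕ) < Cardinal.mk S → ∀ ε > (0:ℝ),
      ∃ g : X → S → ℝ, PartUnitySkelOn n g Set.univ ∧ LipschitzEpsOn ε g Set.univ ∧
        ∃ K : ℝ, 0 < K ∧ CoboundedOn K g Set.univ := by

  intro S hS ε hε
  have : ∃ K, Good n ε K (Set.univ : Set X) := by
    rcases finite_or_infinite X with hX | hX
    · exact good_finite n hε
    · exact good_univ (push_main (extensor_of n hext)) hcad ε hε
  obtain ⟨K, hK⟩ := this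
  exact relabel hK S hS
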